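/- arXiv:2206.07588 — 4 statements merged into one kernel-verified Lean document; each statement's English description precedes it below -/
import Mathlib

section
/- Let H be a separable real Hilbert space and let μ₁, μ₂ be finite nonnegative Borel measures on H. Define m_j(y) = ∫ exp(⟨x, y⟩) dμ_j(x) ∈ [0,∞]. If there exists ε > 0 such that m₁(y) = m₂(y) < ∞ for all y with ‖y‖ ≤ ε, then μ₁ = μ₂. -/
open MeasureTheory Real
open scoped RealInnerProductSpace ENNReal

theorem stmt0 {H : Type*} [NormedAddCommGroup H] [InnerProductSpace ℝ H]
    [CompleteSpace H] [TopologicalSpace.SeparableSpace H]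
    [MeasurableSpace H] [BorelSpace H]
    (μ₁ μ₂ : Measure H) [IsFiniteMeasure μ₁] [IsFiniteMeasure μ₂]
    (ε : ℝ) (hε : 0 < ε)
    (h : ∀ y : H, ‖y‖ ≤ ε →
      (∫⁻ x, ENNReal.ofReal (Real.exp ⟪x, y⟫) ∂μ₁) =
        (∫⁻ x, ENNReal.ofReal (Real.exp ⟪x, y⟫) ∂μ₂) ∧
      (∫⁻ x, ENNReal.ofReal (Real.exp ⟪x, y⟫) ∂μ₁) < ⊤) :
    μ₁ = μ₂ := by
  haveI : SecondCountableTopology H := UniformSpace.secondCountable_of_separable H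
  apply Measure.ext_of_charFun
  funext t
  set r : ℝ := ε / (‖t‖ + 1) with hr
  have hr0 : 0 < r := by positivity
  have hnorm : ∀ s : ℝ, s ∈ Set.Ioo (-r) r → ‖s • t‖ ≤ ε := by
    intro s hs
    have h1 : |s| ≤ r := abs_le.mpr ⟨hs.1.le, hs.2.le⟩
    have h2 : r * (‖t‖ + 1) = ε := by rw [hr]; field_simp
    rw [norm_smul, Real.norm_eq_abs]
    nlinarith [norm_nonneg t]
  have key : ∀ μ : Measure H, IsFiniteMeasure μ →
      (∀ y : H, ‖y‖ ≤ ε → (∫⁻ x, ENNReal.ofReal (Real.exp ⟪x, y⟫) ∂μ) < ⊤) →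
      Set.Ioo (-r) r ⊆ interior (ProbabilityTheory.integrableExpSet (fun x : H => ⟪x, t⟫) μ) := by
    intro μ _ hμ
    refine interior_maximal ?_ isOpen_Ioo
    intro s hs
    change Integrable (fun x : H => Real.exp (s * ⟪x, t⟫)) μ
    refine ⟨by fun_prop, ?_⟩
    rw [hasFiniteIntegral_iff_ofReal (Filter.Eventually.of_forall fun x => (Real.exp_pos _).le)]
    simpa [inner_smul_right] using hμ (s • t) (hnorm s hs)
  have k1 := key μ₁ inferInstance fun y hy => (h y hy).2
  have k2 := key μ₂ inferInstance fun y hy => (h y hy).1 ▸ (h y hy).2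
  have hmgf : ∀ s ∈ Set.Ioo (-r) r,
      ProbabilityTheory.complexMGF (fun x : H => ⟪x, t⟫) μ₁ (s : ℂ) =
      ProbabilityTheory.complexMGF (fun x : H => ⟪x, t⟫) μ₂ (s : ℂ) := by
    intro s hs
    rw [ProbabilityTheory.complexMGF_ofReal, ProbabilityTheory.complexMGF_ofReal]
    congr 1
    have h1 := (h (s • t) (hnorm s hs)).1
    simp only [inner_smul_right] at h1
    unfold ProbabilityTheory.mgf
    rw [integral_eq_lintegral_of_nonneg_ae
        (Filter.Eventually.of_forall fun x => (Real.exp_pos _).le) (by fun_prop),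
      integral_eq_lintegral_of_nonneg_ae
        (Filter.Eventually.of_forall fun x => (Real.exp_pos _).le) (by fun_prop), h1]
  have hEq : Set.EqOn (ProbabilityTheory.complexMGF (fun x : H => ⟪x, t⟫) μ₁)
      (ProbabilityTheory.complexMGF (fun x : H => ⟪x, t⟫) μ₂)
      {z : ℂ | z.re ∈ Set.Ioo (-r) r} := by
    refine AnalyticOnNhd.eqOn_of_preconnected_of_frequently_eq
      (ProbabilityTheory.analyticOnNhd_complexMGF.mono fun z hz => k1 hz)
      (ProbabilityTheory.analyticOnNhd_complexMGF.mono fun z hz => k2 hz)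
      ((convex_Ioo (-r) r).linear_preimage Complex.reLm).isPreconnected
      (z₀ := ((0 : ℝ) : ℂ)) (by simp [hr0]) ?_
    have h_real : ∃ᶠ s : ℝ in nhdsWithin 0 {0}ᶜ,
        ProbabilityTheory.complexMGF (fun x : H => ⟪x, t⟫) μ₁ (s : ℂ) =
        ProbabilityTheory.complexMGF (fun x : H => ⟪x, t⟫) μ₂ (s : ℂ) := by
      apply Filter.Eventually.frequently
      filter_upwards [nhdsWithin_le_nhds (Ioo_mem_nhds (neg_lt_zero.mpr hr0) hr0)] with s hs
      exact hmgf s hs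
    refine Filter.Tendsto.frequently ?_ h_real
    rw [tendsto_nhdsWithin_iff]
    refine ⟨(Complex.continuous_ofReal.tendsto 0).mono_left nhdsWithin_le_nhds, ?_⟩
    filter_upwards [self_mem_nhdsWithin] with s hs
    simpa using hs
  have hI := hEq (x := Complex.I) (by simp [hr0])
  simp only [ProbabilityTheory.complexMGF] at hI
  simp only [charFun_apply]
  simpa only [mul_comm] using hI
end

section
/- Let H be a separable real Hilbert space and let μ be a finite signed Borel measure on H. If ∫∫ exp(-‖x-y‖²/2) dμ(x) dμ(y) = 0 (equivalently, the kernel mean embedding of μ under the Gaussian kernel vanishes), then μ = 0. In other words, the Gaussian kernel k(x,y) = exp(-‖x-y‖²/2) on H is integrally strictly positive definite with respect to all finite signed Borel measures on H. -/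
open MeasureTheory Real

set_option linter.unusedSectionVars false

/-- The double integral of the Gaussian kernel against two measures. -/
noncomputable def gaussD {E : Type*} [NormedAddCommGroup E] [MeasurableSpace E]
    (a b : Measure E) : ℝ := ∫ x, ∫ y, Real.exp (-‖x - y‖ ^ 2 / 2) ∂b ∂a

lemma gaussD_charFun {E : Type*} [NormedAddCommGroup E] [InnerProductSpace ℝ E]
    [FiniteDimensional ℝ E] [MeasurableSpace E] [BorelSpace E]
    (a b : Measure E) [IsFiniteMeasure a] [IsFiniteMeasure b] :
    ((gaussD a b : ℝ) : ℂ) = ∫ t, charFun a t * (starRingEnd ℂ) (charFun b t)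
      ∂(ProbabilityTheory.stdGaussian E) := by
  have hk : ∀ x y : E, ((Real.exp (-‖x - y‖ ^ 2 / 2) : ℝ) : ℂ)
      = ∫ t, Complex.exp (inner ℝ t (x - y) * Complex.I)
        ∂(ProbabilityTheory.stdGaussian E) := by
    intro x y
    rw [← charFun_apply, ProbabilityTheory.charFun_stdGaussian]
    push_cast
    rfl
  have hb : ∀ r : ℝ, ‖Complex.exp (r * Complex.I)‖ = 1 := Complex.norm_exp_ofReal_mul_I
  have hin : ∀ x t : E, ∫ y, Complex.exp (inner ℝ t (x - y) * Complex.I) ∂b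
      = Complex.exp (inner ℝ x t * Complex.I) * (starRingEnd ℂ) (charFun b t) := by
    intro x t
    rw [← charFun_neg, charFun_apply, ← integral_const_mul]
    congr 1
    ext y
    rw [← Complex.exp_add, inner_sub_right, inner_neg_right, real_inner_comm x t,
      real_inner_comm y t]
    push_cast
    ring_nf
  unfold gaussD
  rw [← integral_complex_ofReal]
  simp_rw [← integral_complex_ofReal, hk]
  have h1 : ∀ x : E, ∫ y, ∫ t, Complex.exp (inner ℝ t (x - y) * Complex.I)
        ∂(ProbabilityTheory.stdGaussian E) ∂b
      = ∫ t, Complex.exp (inner ℝ x t * Complex.I) * (starRingEnd ℂ) (charFun b t)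
        ∂(ProbabilityTheory.stdGaussian E) := by
    intro x
    rw [integral_integral_swap]
    · simp_rw [hin]
    · refine Integrable.of_bound (C := 1) ?_ ?_
      · apply Continuous.aestronglyMeasurable
        unfold Function.uncurry
        fun_prop
      · filter_upwards with p
        exact (hb _).le
  simp_rw [h1]
  rw [integral_integral_swap]
  · congr 1
    ext t
    rw [integral_mul_const, ← charFun_apply]
  · refine Integrable.of_bound (C := b.real Set.univ) ?_ ?_
    · apply Measurable.aestronglyMeasurable
      unfold Function.uncurry
      have : Measurable (charFun b) := measurable_charFun
      have h2 : Measurable (fun p : E × E => (starRingEnd ℂ) (charFun b p.2)) :=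
        Complex.continuous_conj.measurable.comp (this.comp measurable_snd)
      exact Measurable.mul (by fun_prop) h2
    · filter_upwards with p
      simp only [Function.uncurry]
      rw [norm_mul, hb, one_mul, RCLike.norm_conj]
      exact norm_charFun_le _

lemma gaussD_nonneg_fin {E : Type*} [NormedAddCommGroup E] [InnerProductSpace ℝ E]
    [FiniteDimensional ℝ E] [MeasurableSpace E] [BorelSpace E]
    (a b : Measure E) [IsFiniteMeasure a] [IsFiniteMeasure b] :
    0 ≤ gaussD a a + gaussD b b - 2 * gaussD a b := by
  have hm : ∀ (c d : Measure E) [IsFiniteMeasure c] [IsFiniteMeasure d],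
      Integrable (fun t => charFun c t * (starRingEnd ℂ) (charFun d t))
        (ProbabilityTheory.stdGaussian E) := by
    intro c d _ _
    refine Integrable.of_bound (C := c.real Set.univ * d.real Set.univ) ?_ ?_
    · exact (measurable_charFun.mul (Complex.continuous_conj.measurable.comp
        measurable_charFun)).aestronglyMeasurable
    · filter_upwards with t
      rw [norm_mul, RCLike.norm_conj]
      exact mul_le_mul (norm_charFun_le _) (norm_charFun_le _) (norm_nonneg _) (by positivity)
  have hre : ∀ (c d : Measure E) [IsFiniteMeasure c] [IsFiniteMeasure d],
      gaussD c d = ∫ t, (charFun c t * (starRingEnd ℂ) (charFun d t)).re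
        ∂(ProbabilityTheory.stdGaussian E) := by
    intro c d _ _
    have h1 := gaussD_charFun c d
    have h2 := integral_re (𝕜 := ℂ) (hm c d)
    simp only [RCLike.re_eq_complex_re] at h2
    rw [h2, ← h1, Complex.ofReal_re]
  have hmr : ∀ (c d : Measure E) [IsFiniteMeasure c] [IsFiniteMeasure d],
      Integrable (fun t => (charFun c t * (starRingEnd ℂ) (charFun d t)).re)
        (ProbabilityTheory.stdGaussian E) := fun c d _ _ => (hm c d).re
  rw [hre a a, hre b b, hre a b, ← integral_const_mul, ← integral_add (hmr a a) (hmr b b),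
    ← integral_sub (f := fun t => (charFun a t * (starRingEnd ℂ) (charFun a t)).re
      + (charFun b t * (starRingEnd ℂ) (charFun b t)).re)
      ((hmr a a).add (hmr b b)) ((hmr a b).const_mul 2)]
  apply integral_nonneg
  intro t
  simp only [Pi.zero_apply, Complex.mul_re, Complex.conj_re, Complex.conj_im]
  nlinarith [sq_nonneg ((charFun a t).re - (charFun b t).re),
    sq_nonneg ((charFun a t).im - (charFun b t).im)]

section
variable {H : Type*} [NormedAddCommGroup H] [InnerProductSpace ℝ H]
    [CompleteSpace H] [TopologicalSpace.SeparableSpace H]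
    [MeasurableSpace H] [BorelSpace H]

lemma gauss_le_one {E : Type*} [NormedAddCommGroup E] (x y : E) :
    ‖Real.exp (-‖x - y‖ ^ 2 / 2)‖ ≤ 1 := by
  rw [Real.norm_eq_abs, Real.abs_exp, Real.exp_le_one_iff]
  have := sq_nonneg ‖x - y‖
  linarith

lemma gaussD_nonneg (a b : Measure H) [IsFiniteMeasure a] [IsFiniteMeasure b] :
    0 ≤ gaussD a a + gaussD b b - 2 * gaussD a b := by
  have : SecondCountableTopology H := UniformSpace.secondCountable_of_separable H
  obtain ⟨u, hu⟩ := TopologicalSpace.exists_dense_seq H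
  let U : ℕ → Submodule ℝ H := fun n => Submodule.span ℝ (u '' Set.Iic n)
  have hfin : ∀ n, FiniteDimensional ℝ (U n) := fun n =>
    FiniteDimensional.span_of_finite ℝ ((Set.finite_Iic n).image u)
  have hmono : Monotone U := fun m n hmn =>
    Submodule.span_mono (Set.image_mono (Set.Iic_subset_Iic.2 hmn))
  have hdense : ⊤ ≤ (⨆ n, U n).topologicalClosure := by
    intro x _
    have : x ∈ closure (Set.range u) := hu x
    refine closure_mono ?_ this
    rintro _ ⟨n, rfl⟩
    exact Submodule.mem_iSup_of_mem n (Submodule.subset_span ⟨n, le_refl n, rfl⟩)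
  have hlim : ∀ x, Filter.Tendsto (fun n => (U n).starProjection x) Filter.atTop (nhds x) :=
    fun x => Submodule.starProjection_tendsto_self U hmono x hdense
  have hD : ∀ (c d : Measure H) [IsFiniteMeasure c] [IsFiniteMeasure d],
      Filter.Tendsto (fun n => gaussD (c.map (U n).orthogonalProjectionOnto)
        (d.map (U n).orthogonalProjectionOnto)) Filter.atTop (nhds (gaussD c d)) := by
    intro c d _ _
    have he : ∀ n, gaussD (c.map (U n).orthogonalProjectionOnto)
        (d.map (U n).orthogonalProjectionOnto) =
        ∫ x, ∫ y, Real.exp (-‖(U n).starProjection x - (U n).starProjection y‖ ^ 2 / 2) ∂d ∂c := by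
      intro n
      unfold gaussD
      rw [integral_map (by fun_prop)]
      · congr 1
        ext x
        rw [integral_map (by fun_prop)]
        · rfl
        · apply Continuous.aestronglyMeasurable
          fun_prop
      · apply StronglyMeasurable.aestronglyMeasurable
        apply StronglyMeasurable.integral_prod_right
        apply Continuous.stronglyMeasurable
        fun_prop
    simp_rw [he]
    unfold gaussD
    have hb : ∀ (x : H) (v : H → H) , ‖∫ y, Real.exp (-‖x - v y‖ ^ 2 / 2) ∂d‖
        ≤ d.real Set.univ := by
      intro x v
      have := norm_integral_le_of_norm_le_const (μ := d) (C := 1)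
        (f := fun y => Real.exp (-‖x - v y‖ ^ 2 / 2))
        (Filter.Eventually.of_forall fun y => gauss_le_one x (v y))
      simpa using this
    apply tendsto_integral_of_dominated_convergence (fun _ => d.real Set.univ)
    · intro n
      apply StronglyMeasurable.aestronglyMeasurable
      apply StronglyMeasurable.integral_prod_right
        (f := fun x y : H =>
          Real.exp (-‖(U n).starProjection x - (U n).starProjection y‖ ^ 2 / 2))
      apply Continuous.stronglyMeasurable
      fun_prop
    · exact integrable_const _
    · intro n
      filter_upwards with x
      exact hb _ _
    · filter_upwards with x
      apply tendsto_integral_of_dominated_convergence (fun _ => 1)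
      · intro n
        apply Continuous.aestronglyMeasurable
        fun_prop
      · exact integrable_const _
      · intro n
        filter_upwards with y
        exact gauss_le_one _ _
      · filter_upwards with y
        have h1 := ((hlim x).sub (hlim y)).norm
        exact (Real.continuous_exp.tendsto _).comp ((h1.pow 2).neg.div_const 2)
  refine ge_of_tendsto' (((hD a a).add (hD b b)).sub ((hD a b).const_mul 2)) fun n => ?_
  exact gaussD_nonneg_fin _ _

lemma gauss_int (b : Measure H) [IsFiniteMeasure b] (x : H) :
    Integrable (fun y => Real.exp (-‖x - y‖ ^ 2 / 2)) b := by
  have : SecondCountableTopology H := UniformSpace.secondCountable_of_separable H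
  refine Integrable.of_bound (C := 1) ?_ ?_
  · apply Continuous.aestronglyMeasurable
    fun_prop
  · filter_upwards with y
    exact gauss_le_one x y

lemma gauss_int2 (a b : Measure H) [IsFiniteMeasure a] [IsFiniteMeasure b] :
    Integrable (fun x => ∫ y, Real.exp (-‖x - y‖ ^ 2 / 2) ∂b) a := by
  have : SecondCountableTopology H := UniformSpace.secondCountable_of_separable H
  refine Integrable.of_bound (C := b.real Set.univ) ?_ ?_
  · apply StronglyMeasurable.aestronglyMeasurable
    apply StronglyMeasurable.integral_prod_right
      (f := fun x y : H => Real.exp (-‖x - y‖ ^ 2 / 2))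
    apply Continuous.stronglyMeasurable
    fun_prop
  · filter_upwards with x
    have := norm_integral_le_of_norm_le_const (μ := b) (C := 1)
        (f := fun y => Real.exp (-‖x - y‖ ^ 2 / 2))
        (Filter.Eventually.of_forall fun y => gauss_le_one x y)
    simpa using this

lemma gaussD_comm (a b : Measure H) [IsFiniteMeasure a] [IsFiniteMeasure b] :
    gaussD a b = gaussD b a := by
  have : SecondCountableTopology H := UniformSpace.secondCountable_of_separable H
  unfold gaussD
  rw [integral_integral_swap]
  · simp_rw [norm_sub_rev]
  · refine Integrable.of_bound (C := 1) ?_ ?_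
    · apply Continuous.aestronglyMeasurable
      unfold Function.uncurry
      fun_prop
    · filter_upwards with y
      exact gauss_le_one _ _

lemma gaussD_add_left (a a' b : Measure H) [IsFiniteMeasure a] [IsFiniteMeasure a']
    [IsFiniteMeasure b] : gaussD (a + a') b = gaussD a b + gaussD a' b := by
  unfold gaussD
  exact integral_add_measure (gauss_int2 a b) (gauss_int2 a' b)

lemma gaussD_smul_dirac_left (t : NNReal) (z : H) (b : Measure H) :
    gaussD (t • Measure.dirac z) b = t * ∫ y, Real.exp (-‖z - y‖ ^ 2 / 2) ∂b := by
  unfold gaussD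
  rw [integral_smul_nnreal_measure, integral_dirac]
  rfl

/-- One-sided vanishing of the mean embedding. -/
lemma embed_le (a b : Measure H) [IsFiniteMeasure a] [IsFiniteMeasure b]
    (h : gaussD a a + gaussD b b - 2 * gaussD a b = 0) (z : H) :
    ∫ y, Real.exp (-‖z - y‖ ^ 2 / 2) ∂b ≤ ∫ y, Real.exp (-‖z - y‖ ^ 2 / 2) ∂a := by
  set A := ∫ y, Real.exp (-‖z - y‖ ^ 2 / 2) ∂a with hA
  set B := ∫ y, Real.exp (-‖z - y‖ ^ 2 / 2) ∂b with hB
  have key : ∀ t : NNReal, 0 ≤ 2 * (t : ℝ) * (A - B) + (t : ℝ) ^ 2 := by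
    intro t
    have h0 := gaussD_nonneg (a + t • Measure.dirac z) b
    rw [gaussD_add_left, gaussD_comm a (a + _), gaussD_add_left, gaussD_add_left,
      gaussD_comm (t • Measure.dirac z) (a + _), gaussD_add_left,
      gaussD_comm a (t • Measure.dirac z), gaussD_smul_dirac_left, gaussD_smul_dirac_left,
      gaussD_smul_dirac_left, integral_smul_nnreal_measure, integral_dirac, ← hA, ← hB] at h0
    simp only [sub_self, norm_zero] at h0
    norm_num [NNReal.smul_def] at h0
    nlinarith
  by_contra hlt
  push Not at hlt
  have := key ⟨B - A, by linarith⟩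
  change 0 ≤ 2 * (B - A) * (A - B) + (B - A) ^ 2 at this
  nlinarith [mul_pos (sub_pos.2 hlt) (sub_pos.2 hlt)]

/-- The measure weighted by a Gaussian density. -/
noncomputable def gaussW {E : Type*} [NormedAddCommGroup E] [MeasurableSpace E]
    (a : Measure E) : Measure E :=
  a.withDensity (fun y => ENNReal.ofReal (Real.exp (-‖y‖ ^ 2 / 2)))

lemma gaussW_inj (a b : Measure H) (h : gaussW a = gaussW b) : a = b := by
  have hm : Measurable (fun y : H => ENNReal.ofReal (Real.exp (-‖y‖ ^ 2 / 2))) := by fun_prop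
  have hc : ∀ c : Measure H, (gaussW c).withDensity
      (fun y => (ENNReal.ofReal (Real.exp (-‖y‖ ^ 2 / 2)))⁻¹) = c := by
    intro c
    apply withDensity_inv_same hm
    · filter_upwards with y
      simp [Real.exp_pos]
    · filter_upwards with y
      simp
  rw [← hc a, h, hc b]

lemma gaussW_finite (a : Measure H) [IsFiniteMeasure a] : IsFiniteMeasure (gaussW a) := by
  apply isFiniteMeasure_withDensity_ofReal
  refine (Integrable.of_bound (μ := a) (C := 1) ?_ ?_).2
  · have : Measurable (fun y : H => Real.exp (-‖y‖ ^ 2 / 2)) := by fun_prop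
    exact this.aestronglyMeasurable
  · filter_upwards with y
    simpa using gauss_le_one y 0

lemma gaussW_exp (w y : H) :
    (ENNReal.ofReal (Real.exp (-‖y‖ ^ 2 / 2))).toReal • Real.exp (inner ℝ y w)
      = Real.exp (‖w‖ ^ 2 / 2) * Real.exp (-‖w - y‖ ^ 2 / 2) := by
  rw [ENNReal.toReal_ofReal (Real.exp_pos _).le, smul_eq_mul, ← Real.exp_add, ← Real.exp_add,
    norm_sub_sq_real, real_inner_comm]
  ring_nf

lemma gaussW_integrable (a : Measure H) [IsFiniteMeasure a] (w : H) :
    Integrable (fun y => Real.exp (inner ℝ y w)) (gaussW a) := by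
  unfold gaussW
  have hm : Measurable (fun y : H => ENNReal.ofReal (Real.exp (-‖y‖ ^ 2 / 2))) := by fun_prop
  rw [integrable_withDensity_iff_integrable_smul' hm (by simp)]
  simp_rw [gaussW_exp w]
  exact (gauss_int a w).const_mul _

lemma gaussW_integral (a : Measure H) [IsFiniteMeasure a] (w : H) :
    ∫ y, Real.exp (inner ℝ y w) ∂(gaussW a)
      = Real.exp (‖w‖ ^ 2 / 2) * ∫ y, Real.exp (-‖w - y‖ ^ 2 / 2) ∂a := by
  unfold gaussW
  have hm : Measurable (fun y : H => ENNReal.ofReal (Real.exp (-‖y‖ ^ 2 / 2))) := by fun_prop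
  rw [integral_withDensity_eq_integral_toReal_smul hm (by simp), ← integral_const_mul]
  simp_rw [gaussW_exp w]

lemma eq_of_embed (a b : Measure H) [IsFiniteMeasure a] [IsFiniteMeasure b]
    (h : ∀ z, ∫ y, Real.exp (-‖z - y‖ ^ 2 / 2) ∂a = ∫ y, Real.exp (-‖z - y‖ ^ 2 / 2) ∂b) :
    a = b := by
  have : SecondCountableTopology H := UniformSpace.secondCountable_of_separable H
  apply gaussW_inj
  have := gaussW_finite a
  have := gaussW_finite b
  apply Measure.ext_of_charFun
  ext t
  have hL : ∀ w, ∫ y, Real.exp (inner ℝ y w) ∂(gaussW a)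
      = ∫ y, Real.exp (inner ℝ y w) ∂(gaussW b) := by
    intro w
    rw [gaussW_integral, gaussW_integral, h]
  have hmgf : ProbabilityTheory.mgf (fun y : H => inner ℝ y t) (gaussW a)
      = ProbabilityTheory.mgf (fun y : H => inner ℝ y t) (gaussW b) := by
    ext s
    have := hL (s • t)
    simp_rw [inner_smul_right] at this
    exact this
  have hz : gaussW a = 0 ↔ gaussW b = 0 := by
    have := hL 0
    simp only [inner_zero_right, Real.exp_zero, integral_const, smul_eq_mul, mul_one] at this
    rw [← Measure.measure_univ_eq_zero, ← Measure.measure_univ_eq_zero,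
      ← measureReal_eq_zero_iff, ← measureReal_eq_zero_iff, this]
  have hset : ProbabilityTheory.integrableExpSet (fun y : H => inner ℝ y t) (gaussW a)
      = Set.univ := by
    ext s
    simp only [Set.mem_univ, iff_true]
    have := gaussW_integrable a (s • t)
    simp_rw [inner_smul_right] at this
    exact this
  have := ProbabilityTheory.eqOn_complexMGF_of_mgf' hmgf hz (x := Complex.I) (by simp [hset])
  simp only [ProbabilityTheory.complexMGF] at this
  simp_rw [charFun_apply]
  simpa only [mul_comm Complex.I] using this

end

theorem stmt1 {H : Type*} [NormedAddCommGroup H] [InnerProductSpace ℝ H]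
    [CompleteSpace H] [TopologicalSpace.SeparableSpace H]
    [MeasurableSpace H] [BorelSpace H]
    (μp μm : Measure H) [IsFiniteMeasure μp] [IsFiniteMeasure μm]
    (h : (∫ x, ∫ y, Real.exp (-‖x - y‖ ^ 2 / 2) ∂μp ∂μp)
        + (∫ x, ∫ y, Real.exp (-‖x - y‖ ^ 2 / 2) ∂μm ∂μm)
        - 2 * (∫ x, ∫ y, Real.exp (-‖x - y‖ ^ 2 / 2) ∂μm ∂μp) = 0) :
    μp = μm := by
  have h' : gaussD μp μp + gaussD μm μm - 2 * gaussD μp μm = 0 := h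
  have h'' : gaussD μm μm + gaussD μp μp - 2 * gaussD μm μp = 0 := by
    rw [gaussD_comm μm μp]
    linarith
  exact eq_of_embed μp μm fun z => le_antisymm (embed_le μm μp h'' z) (embed_le μp μm h' z)
end

section
/- Let (X, ρ) be a metric space of strong negative type, meaning: for every finite signed Borel measure μ on X with μ(X) = 0 and ∫ ρ(x, z₀) d|μ|(x) < ∞ for some z₀, ∫∫ ρ(x,y) dμ(x) dμ(y) = 0 implies μ = 0. Then the Laplace kernel k(x,y) = exp(-ρ(x,y)) is characteristic: for every finite signed Borel measure μ on X with μ(X) = 0, ∫∫ exp(-ρ(x,y)) dμ(x) dμ(y) = 0 implies μ = 0. -/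
open MeasureTheory Real

/-- The double integral `∫∫ f d(μp - μm) d(μp - μm)` of a bounded measurable function
with respect to the finite signed measure `μ = μp - μm`, written out in terms of the
nonnegative parts. -/
noncomputable def dblInt {X : Type*} [MeasurableSpace X] (f : X → X → ℝ)
    (μp μm : Measure X) : ℝ :=
  (∫ x, ∫ y, f x y ∂μp ∂μp) - (∫ x, ∫ y, f x y ∂μm ∂μp)
    - (∫ x, ∫ y, f x y ∂μp ∂μm) + (∫ x, ∫ y, f x y ∂μm ∂μm)


universe u

lemma psd_feature {X : Type u} (L : Matrix X X ℝ) (hL : L.PosSemidef) :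
    ∃ (H : Type u) (_ : NormedAddCommGroup H) (_ : InnerProductSpace ℝ H) (_ : CompleteSpace H)
      (φ : X → H), ∀ x y, inner ℝ (φ x) (φ y) = L x y := by
  let K : Matrix X X (ℝ →L[ℝ] ℝ) := .of fun x y => L x y • ContinuousLinearMap.id ℝ ℝ
  have hherm : K.IsHermitian := by
    ext x y
    have h1 : L y x = L x y := by simpa using hL.1.apply x y
    have h2 : star (ContinuousLinearMap.id ℝ ℝ) = ContinuousLinearMap.id ℝ ℝ :=
      star_one (ℝ →L[ℝ] ℝ)
    simp [K, Matrix.conjTranspose_apply, h1, h2]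
  have hK : K.PosSemidef := by
    have key := (RKHS.posSemidef_tfae (K := K)).out 0 2
    refine key.mpr ⟨hherm, fun vv => ?_⟩
    have := hL.2 vv
    rw [Finsupp.sum_comm] at this
    simp only [K, RCLike.re_to_real]
    refine this.trans_eq ?_
    refine Finsupp.sum_congr fun x _ => Finsupp.sum_congr fun y _ => ?_
    simp
    ring
  have : Fact K.PosSemidef := ⟨hK⟩
  refine ⟨RKHS.OfKernel K, inferInstance, inferInstance, inferInstance,
    fun x => RKHS.kerFun (RKHS.OfKernel K) x (1 : ℝ), fun x y => ?_⟩
  rw [← RKHS.kernel_inner, RKHS.OfKernel.kernel_ofKernel]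
  have h1 : L y x = L x y := by simpa using hL.1.apply x y
  simp [K, h1]

lemma weak_integral {X : Type*} [MetricSpace X] [MeasurableSpace X] [BorelSpace X]
    {H : Type*} [NormedAddCommGroup H] [InnerProductSpace ℝ H] [CompleteSpace H]
    (φ : X → H) (hφ : Continuous φ) (C : ℝ) (hC : ∀ x, ‖φ x‖ ≤ C)
    (μ : Measure X) [IsFiniteMeasure μ] :
    ∃ b : H, ∀ h : H, ∫ x, inner ℝ h (φ x) ∂μ = inner ℝ h b := by
  have hint : ∀ h : H, Integrable (fun x => inner ℝ h (φ x)) μ := fun h => by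
    refine Integrable.of_bound (C := ‖h‖ * C)
      (Continuous.aestronglyMeasurable (by fun_prop)) (Filter.Eventually.of_forall fun x => ?_)
    exact (norm_inner_le_norm _ _).trans (by gcongr; exact hC x)
  let T : H →ₗ[ℝ] ℝ :=
    { toFun := fun h => ∫ x, inner ℝ h (φ x) ∂μ
      map_add' := fun h k => by
        simp only [inner_add_left]
        exact integral_add (hint h) (hint k)
      map_smul' := fun c h => by
        simp only [real_inner_smul_left]
        exact integral_const_mul _ _ }
  let T' : H →L[ℝ] ℝ := T.mkContinuous (C * μ.real Set.univ) (fun h => by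
    refine (norm_integral_le_of_norm_le_const (C := ‖h‖ * C)
      (Filter.Eventually.of_forall fun x => ?_)).trans_eq (by ring)
    exact (norm_inner_le_norm _ _).trans (by gcongr; exact hC x))
  refine ⟨(InnerProductSpace.toDual ℝ H).symm T', fun h => ?_⟩
  rw [real_inner_comm, InnerProductSpace.toDual_symm_apply]
  rfl

lemma dblInt_nonneg {X : Type*} [MetricSpace X] [MeasurableSpace X] [BorelSpace X]
    (L : X → X → ℝ) (hL : (Matrix.of L).PosSemidef) (hc : Continuous fun p : X × X => L p.1 p.2)
    (C : ℝ) (hC : ∀ x, L x x ≤ C)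
    (μp μm : Measure X) [IsFiniteMeasure μp] [IsFiniteMeasure μm] :
    0 ≤ dblInt L μp μm := by
  obtain ⟨H, _, _, _, φ, hφ⟩ := psd_feature _ hL
  simp only [Matrix.of_apply] at hφ
  have hn : ∀ x, ‖φ x‖ ≤ √C := fun x => by
    apply Real.le_sqrt_of_sq_le
    rw [← real_inner_self_eq_norm_sq, hφ]
    exact hC x
  have hcont : Continuous φ := by
    rw [continuous_iff_continuousAt]
    intro x
    rw [ContinuousAt, tendsto_iff_norm_sub_tendsto_zero]
    have h1 : Continuous fun y => √(L y y - 2 * L y x + L x x) := by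
      have e1 : Continuous fun y => L y y := hc.comp (continuous_id.prodMk continuous_id)
      have e2 : Continuous fun y => L y x := hc.comp (continuous_id.prodMk continuous_const)
      fun_prop
    have h2 := h1.tendsto x
    have h3 : (fun y => ‖φ y - φ x‖) = fun y => √(L y y - 2 * L y x + L x x) := by
      funext y
      rw [← Real.sqrt_sq (norm_nonneg (φ y - φ x)), norm_sub_sq_real,
        ← real_inner_self_eq_norm_sq, ← real_inner_self_eq_norm_sq, hφ, hφ, hφ]
    rw [h3]
    convert h2 using 2
    rw [show L x x - 2 * L x x + L x x = 0 by ring, Real.sqrt_zero]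
  obtain ⟨bp, hbp⟩ := weak_integral φ hcont _ hn μp
  obtain ⟨bm, hbm⟩ := weak_integral φ hcont _ hn μm
  have : dblInt L μp μm = inner ℝ (bp - bm) (bp - bm) := by
    unfold dblInt
    simp only [← hφ, hbp, hbm]
    simp only [real_inner_comm _ (φ _), hbp, hbm, inner_sub_left, inner_sub_right]
    rw [real_inner_comm bm bp]
    ring
  rw [this]
  exact real_inner_self_nonneg

/-- The discrete measure with weights the positive part of `d`. -/
noncomputable def discM {X : Type*} [MeasurableSpace X] (d : X →₀ ℝ) (s : ℝ) : Measure X :=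
  ∑ x ∈ d.support, ENNReal.ofReal (s * d x) • Measure.dirac x

lemma discM_finite {X : Type*} [MeasurableSpace X] (d : X →₀ ℝ) (s : ℝ) :
    IsFiniteMeasure (discM d s) := by
  constructor
  simp [discM, ENNReal.sum_lt_top]

lemma discM_integrable {X : Type*} [MetricSpace X] [MeasurableSpace X] [BorelSpace X]
    (d : X →₀ ℝ) (s : ℝ) (f : X → ℝ) : Integrable f (discM d s) := by
  refine integrable_finsetSum_measure.mpr fun x _ => ?_
  exact (integrable_dirac (by simp)).smul_measure ENNReal.ofReal_ne_top

lemma discM_integral {X : Type*} [MetricSpace X] [MeasurableSpace X] [BorelSpace X]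
    (d : X →₀ ℝ) (s : ℝ) (f : X → ℝ) :
    ∫ x, f x ∂(discM d s) = ∑ x ∈ d.support, max (s * d x) 0 * f x := by
  unfold discM
  rw [integral_finsetSum_measure]
  · refine Finset.sum_congr rfl fun x _ => ?_
    rw [integral_smul_measure, integral_dirac, ENNReal.toReal_ofReal', smul_eq_mul]
  · intro x _
    exact (integrable_dirac (by simp)).smul_measure ENNReal.ofReal_ne_top

lemma discM_sub {X : Type*} [MetricSpace X] [MeasurableSpace X] [BorelSpace X]
    (d : X →₀ ℝ) (f : X → ℝ) :
    ∫ x, f x ∂(discM d 1) - ∫ x, f x ∂(discM d (-1)) = ∑ x ∈ d.support, d x * f x := by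
  rw [discM_integral, discM_integral, ← Finset.sum_sub_distrib]
  refine Finset.sum_congr rfl fun x _ => ?_
  rw [← sub_mul]
  congr 1
  rcases le_total 0 (d x) with h | h
  · rw [max_eq_left (by linarith), max_eq_right (by linarith)]; ring
  · rw [max_eq_right (by linarith), max_eq_left (by linarith)]; ring

lemma discM_dblInt {X : Type*} [MetricSpace X] [MeasurableSpace X] [BorelSpace X]
    (d : X →₀ ℝ) (f : X → X → ℝ) :
    dblInt f (discM d 1) (discM d (-1)) = d.sum fun x a => d.sum fun y b => a * f x y * b := by
  have h1 : dblInt f (discM d 1) (discM d (-1)) =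
      ∫ x, (∫ y, f x y ∂(discM d 1) - ∫ y, f x y ∂(discM d (-1))) ∂(discM d 1) -
      ∫ x, (∫ y, f x y ∂(discM d 1) - ∫ y, f x y ∂(discM d (-1))) ∂(discM d (-1)) := by
    rw [integral_sub (discM_integrable _ _ _) (discM_integrable _ _ _),
      integral_sub (discM_integrable _ _ _) (discM_integrable _ _ _)]
    unfold dblInt
    ring
  rw [h1, discM_sub]
  simp only [discM_sub, Finsupp.sum, Finset.mul_sum]
  refine Finset.sum_congr rfl fun x _ => Finset.sum_congr rfl fun y _ => ?_
  ring

lemma discM_singleton {X : Type*} [MetricSpace X] [MeasurableSpace X] [BorelSpace X]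
    (d : X →₀ ℝ) (s : ℝ) (x : X) : discM d s {x} = ENNReal.ofReal (s * d x) := by
  classical
  simp only [discM, Measure.coe_finsetSum, Finset.sum_apply, Measure.smul_apply, smul_eq_mul,
    Measure.dirac_apply, Set.indicator_apply, Set.mem_singleton_iff, Pi.one_apply]
  simp only [mul_ite, mul_one, mul_zero, Finset.sum_ite_eq']
  split_ifs with h
  · rfl
  · simp [Finsupp.notMem_support_iff.mp h]

/-- the hypothesis -/
def SNT (X : Type*) [MetricSpace X] [MeasurableSpace X] : Prop :=
  ∀ (μp μm : Measure X), IsFiniteMeasure μp → IsFiniteMeasure μm →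
      μp Set.univ = μm Set.univ →
      (∃ z₀ : X, (∫⁻ x, ENNReal.ofReal (dist x z₀) ∂(μp + μm)) < ⊤) →
      dblInt (fun x y => dist x y) μp μm = 0 → μp = μm

/-- the quadratic form -/
noncomputable def Qf {X : Type*} (f : X → X → ℝ) (d e : X →₀ ℝ) : ℝ :=
  d.sum fun x a => e.sum fun y b => a * f x y * b

lemma Qf_add_left {X : Type*} (f : X → X → ℝ) (d d' e : X →₀ ℝ) :
    Qf f (d + d') e = Qf f d e + Qf f d' e := by
  unfold Qf
  rw [Finsupp.sum_add_index']
  · simp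
  · intro x a b
    simp [add_mul, Finsupp.sum_add]

lemma Qf_add_right {X : Type*} (f : X → X → ℝ) (d e e' : X →₀ ℝ) :
    Qf f d (e + e') = Qf f d e + Qf f d e' := by
  unfold Qf
  rw [← Finsupp.sum_add]
  refine Finsupp.sum_congr fun x _ => ?_
  rw [Finsupp.sum_add_index']
  · simp
  · intro x a b
    ring

lemma Qf_smul_left {X : Type*} (f : X → X → ℝ) (s : ℝ) (d e : X →₀ ℝ) :
    Qf f (s • d) e = s * Qf f d e := by
  unfold Qf
  rw [Finsupp.sum_smul_index' (by simp), Finsupp.mul_sum]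
  refine Finsupp.sum_congr fun x _ => ?_
  rw [Finsupp.mul_sum]
  refine Finsupp.sum_congr fun y _ => ?_
  rw [smul_eq_mul]; ring

lemma Qf_smul_right {X : Type*} (f : X → X → ℝ) (s : ℝ) (d e : X →₀ ℝ) :
    Qf f d (s • e) = s * Qf f d e := by
  unfold Qf
  rw [Finsupp.mul_sum]
  refine Finsupp.sum_congr fun x _ => ?_
  rw [Finsupp.sum_smul_index' (by simp), Finsupp.mul_sum]
  refine Finsupp.sum_congr fun y _ => ?_
  rw [smul_eq_mul]; ring

lemma Qf_single {X : Type*} (f : X → X → ℝ) (x y : X) (a b : ℝ) :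
    Qf f (Finsupp.single x a) (Finsupp.single y b) = a * f x y * b := by
  unfold Qf
  rw [Finsupp.sum_single_index (by simp), Finsupp.sum_single_index (by simp)]

lemma disc_zero {X : Type*} [MetricSpace X] [MeasurableSpace X] [BorelSpace X]
    (hsnt : SNT X) (d : X →₀ ℝ) (hd : d.sum (fun _ a => a) = 0)
    (hQ : Qf (fun x y => dist x y) d d = 0) : d = 0 := by
  rcases isEmpty_or_nonempty X with h | ⟨⟨z⟩⟩
  · ext x; exact h.elim x
  have := discM_finite d 1
  have := discM_finite d (-1)
  have heq : discM d 1 = discM d (-1) := by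
    refine hsnt _ _ inferInstance inferInstance ?_ ⟨z, ?_⟩ ?_
    · have h := discM_sub d (fun _ => 1)
      simp only [integral_const, smul_eq_mul, mul_one] at h
      change _ = d.sum (fun _ a => a) at h
      rw [hd, sub_eq_zero] at h
      exact (measureReal_eq_measureReal_iff).mp h
    · have h1 := (discM_integrable d 1 (fun x => dist x z)).add_measure
        (discM_integrable d (-1) (fun x => dist x z))
      exact h1.lintegral_lt_top
    · rw [discM_dblInt]; exact hQ
  ext x
  have h1 := discM_singleton d 1 x
  rw [heq, discM_singleton] at h1
  have h2 := congrArg ENNReal.toReal h1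
  rw [ENNReal.toReal_ofReal', ENNReal.toReal_ofReal'] at h2
  rcases le_total 0 (d x) with h | h
  · rw [max_eq_right (by linarith), max_eq_left (by linarith)] at h2
    simp at h2 ⊢; linarith
  · rw [max_eq_left (by linarith), max_eq_right (by linarith)] at h2
    simp at h2 ⊢; linarith

lemma exists_quad_root (a b c : ℝ) (ha : a < 0) (hc : 0 < c) :
    ∃ s : ℝ, a * (s * s) + b * s + c = 0 := by
  apply exists_quadratic_eq_zero ha.ne
  refine ⟨√(discrim a b c), ?_⟩
  rw [Real.mul_self_sqrt]
  unfold discrim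
  nlinarith [sq_nonneg b]

lemma disc_nonpos {X : Type*} [MetricSpace X] [MeasurableSpace X] [BorelSpace X]
    (hsnt : SNT X) (d : X →₀ ℝ) (hd : d.sum (fun _ a => a) = 0) :
    Qf (fun x y => dist x y) d d ≤ 0 := by
  by_contra! hpos
  have hxy : ∃ x y : X, x ≠ y := by
    by_contra! hxy
    have : Qf (fun x y => dist x y) d d = 0 := by
      unfold Qf
      have h0 : ∀ x y : X, dist x y = 0 := fun x y => by rw [hxy x y, dist_self]
      simp [h0, Finsupp.sum]
    linarith
  obtain ⟨x, y, hxy⟩ := hxy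
  set e : X →₀ ℝ := Finsupp.single x 1 + Finsupp.single y (-1) with he
  have hQe : Qf (fun x y => dist x y) e e < 0 := by
    simp only [he, Qf_add_left, Qf_add_right, Qf_single]
    have := dist_pos.mpr hxy
    simp only [dist_comm y x, dist_self]
    linarith
  have hes : e.sum (fun _ a => a) = 0 := by
    rw [he, Finsupp.sum_add_index' (by simp) (by simp), Finsupp.sum_single_index rfl,
      Finsupp.sum_single_index rfl]
    simp
  obtain ⟨s, hs⟩ := exists_quad_root _ (Qf (fun x y => dist x y) d e +
    Qf (fun x y => dist x y) e d) _ hQe hpos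
  have h0 : d + s • e = 0 := by
    apply disc_zero hsnt
    · rw [Finsupp.sum_add_index' (by simp) (by simp), hd,
        Finsupp.sum_smul_index' (by simp), ← Finsupp.smul_sum, hes]
      simp
    · simp only [Qf_add_left, Qf_add_right, Qf_smul_left, Qf_smul_right]
      linarith
  have hde : d = (-s) • e := by
    rw [neg_smul]; exact eq_neg_of_add_eq_zero_left h0
  rw [hde, Qf_smul_left, Qf_smul_right] at hpos
  nlinarith [mul_self_nonneg s]

/-- the centred kernel -/
noncomputable def Kc {X : Type*} [MetricSpace X] (z x y : X) : ℝ :=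
  dist x z + dist y z - dist x y

lemma Kc_psd {X : Type*} [MetricSpace X] [MeasurableSpace X] [BorelSpace X]
    (hsnt : SNT X) (z : X) : (Matrix.of (Kc z)).PosSemidef := by
  refine ⟨?_, fun c => ?_⟩
  · ext x y
    simp [Kc, dist_comm x y, add_comm]
  set m := c.sum (fun _ a => a) with hm
  have h := disc_nonpos hsnt (c + Finsupp.single z (-m)) (by
    rw [Finsupp.sum_add_index' (by simp) (by simp), Finsupp.sum_single_index rfl, ← hm]
    simp)
  simp only [Qf_add_left, Qf_add_right, Qf_single] at h
  have e1 : Qf (fun x y => dist x y) c (Finsupp.single z (-m)) =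
      -m * c.sum (fun x a => a * dist x z) := by
    unfold Qf
    rw [Finsupp.mul_sum]
    refine Finsupp.sum_congr fun x _ => ?_
    rw [Finsupp.sum_single_index (by simp)]; ring
  have e2 : Qf (fun x y => dist x y) (Finsupp.single z (-m)) c =
      -m * c.sum (fun x a => a * dist x z) := by
    unfold Qf
    rw [Finsupp.sum_single_index (by simp), Finsupp.mul_sum]
    refine Finsupp.sum_congr fun x _ => ?_
    rw [dist_comm]; ring
  have e3 : (c.sum fun i xi ↦ c.sum fun j xj ↦ star xi * Matrix.of (Kc z) i j * xj) =
      2 * m * c.sum (fun x a => a * dist x z) - Qf (fun x y => dist x y) c c := by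
    have e4 : m * c.sum (fun x a => a * dist x z) =
        c.sum fun x a => c.sum fun y b => a * dist x z * b := by
      rw [hm, mul_comm, Finsupp.sum_mul]
      exact Finsupp.sum_congr fun x _ => by rw [Finsupp.mul_sum]
    have e5 : m * c.sum (fun x a => a * dist x z) =
        c.sum fun x a => c.sum fun y b => a * dist y z * b := by
      rw [hm, Finsupp.sum_mul]
      refine Finsupp.sum_congr fun x _ => ?_
      rw [Finsupp.mul_sum]
      exact Finsupp.sum_congr fun y _ => by ring
    rw [show 2 * m * c.sum (fun x a => a * dist x z) = m * c.sum (fun x a => a * dist x z) +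
      m * c.sum (fun x a => a * dist x z) by ring]
    nth_rewrite 1 [e4]
    rw [e5]
    unfold Qf
    rw [← Finsupp.sum_add, ← Finsupp.sum_sub]
    refine Finsupp.sum_congr fun x _ => ?_
    rw [← Finsupp.sum_add, ← Finsupp.sum_sub]
    refine Finsupp.sum_congr fun y _ => ?_
    simp [Kc]; ring
  rw [e3]
  rw [e1, e2] at h
  simp at h
  linarith

lemma rankone_psd {X : Type*} (u : X → ℝ) : (Matrix.of fun x y => u x * u y).PosSemidef := by
  refine ⟨?_, fun c => ?_⟩
  · ext x y
    simp [mul_comm]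
  · have : (c.sum fun i xi ↦ c.sum fun j xj ↦
        star xi * Matrix.of (fun x y => u x * u y) i j * xj) =
        (c.sum fun x a => a * u x) * (c.sum fun x a => a * u x) := by
      rw [Finsupp.sum_mul]
      refine Finsupp.sum_congr fun x _ => ?_
      rw [Finsupp.mul_sum]
      refine Finsupp.sum_congr fun y _ => ?_
      simp; ring
    rw [this]
    exact mul_self_nonneg _

lemma pow_psd {X : Type*} (K : X → X → ℝ) (hK : (Matrix.of K).PosSemidef) (n : ℕ) :
    (Matrix.of fun x y => K x y ^ n).PosSemidef := by
  induction n with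
  | zero => simpa using rankone_psd (fun _ : X => (1 : ℝ))
  | succ n ih =>
    have := ih.hadamard hK
    have h2 : (Matrix.of fun x y => K x y ^ (n + 1)) =
        (Matrix.of fun x y => K x y ^ n).hadamard (Matrix.of K) := by
      ext x y
      simp [Matrix.hadamard, pow_succ]
    rw [h2]
    exact this

lemma exp_psd {X : Type*} (K : X → X → ℝ) (hK : (Matrix.of K).PosSemidef) :
    (Matrix.of fun x y => Real.exp (K x y) - 1 - K x y).PosSemidef := by
  have hs : ∀ r : ℝ, HasSum (fun n : ℕ => r ^ (n + 2) / (n + 2).factorial) (Real.exp r - 1 - r) := by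
    intro r
    have h1 := NormedSpace.expSeries_div_hasSum_exp r
    rw [← Real.exp_eq_exp_ℝ] at h1
    have h2 := (hasSum_nat_add_iff' 2).mpr h1
    have h3 : Real.exp r - ∑ i ∈ Finset.range 2, r ^ i / (i.factorial : ℝ) =
        Real.exp r - 1 - r := by
      rw [Finset.sum_range_succ, Finset.sum_range_one]
      norm_num
      ring
    rw [← h3]
    exact h2
  have hsym : ∀ x y, K y x = K x y := fun x y => by simpa using hK.1.apply x y
  refine ⟨?_, fun c => ?_⟩
  · ext x y
    simp [hsym]
  · have hsum : HasSum (fun n : ℕ => c.sum fun i xi ↦ c.sum fun j xj ↦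
        xi * (K i j ^ (n + 2) / (n + 2).factorial) * xj)
        (c.sum fun i xi ↦ c.sum fun j xj ↦ xi * (Real.exp (K i j) - 1 - K i j) * xj) := by
      unfold Finsupp.sum
      refine hasSum_sum fun i _ => hasSum_sum fun j _ => ?_
      exact ((hs _).mul_left _).mul_right _
    refine (hsum.nonneg fun n => ?_).trans_eq (by simp)
    have h := (pow_psd K hK (n + 2)).2 c
    have h2 : (c.sum fun i xi ↦ c.sum fun j xj ↦
        xi * (K i j ^ (n + 2) / (n + 2).factorial) * xj) =
        (1 / ((n + 2).factorial : ℝ)) * (c.sum fun i xi ↦ c.sum fun j xj ↦ star xi *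
          Matrix.of (fun x y => K x y ^ (n + 2)) i j * xj) := by
      rw [Finsupp.mul_sum]
      refine Finsupp.sum_congr fun i _ => ?_
      rw [Finsupp.mul_sum]
      refine Finsupp.sum_congr fun j _ => ?_
      simp; ring
    rw [h2]
    exact mul_nonneg (by positivity) h

/-- jointly continuous and bounded -/
def Good {X : Type*} [MetricSpace X] (f : X → X → ℝ) : Prop :=
  (Continuous fun p : X × X => f p.1 p.2) ∧ ∃ C, ∀ x y, |f x y| ≤ C

section
variable {X : Type*} [MetricSpace X] [MeasurableSpace X] [BorelSpace X]

lemma Good.int1 {f : X → X → ℝ} (hf : Good f) (μ : Measure X) [IsFiniteMeasure μ] (x : X) :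
    Integrable (f x) μ := by
  obtain ⟨hc, C, hC⟩ := hf
  have e : Continuous (f x) := hc.comp (continuous_const.prodMk continuous_id)
  exact Integrable.of_bound (C := C) e.aestronglyMeasurable
    (Filter.Eventually.of_forall fun y => hC x y)

lemma Good.int2 {f : X → X → ℝ} (hf : Good f) (μ ν : Measure X) [IsFiniteMeasure μ]
    [IsFiniteMeasure ν] : Integrable (fun x => ∫ y, f x y ∂μ) ν := by
  obtain ⟨hc, C, hC⟩ := hf
  have e : ∀ x, Continuous (f x) := fun x => hc.comp (continuous_const.prodMk continuous_id)
  have e' : ∀ y, Continuous (fun x => f x y) := fun y =>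
    hc.comp (continuous_id.prodMk continuous_const)
  have h1 : Continuous fun x => ∫ y, f x y ∂μ :=
    continuous_of_dominated (bound := fun _ => C) (fun x => (e x).aestronglyMeasurable)
      (fun x => Filter.Eventually.of_forall fun y => hC x y) (integrable_const _)
      (Filter.Eventually.of_forall fun y => e' y)
  exact Integrable.of_bound (C := C * μ.real Set.univ) h1.aestronglyMeasurable
    (Filter.Eventually.of_forall fun x => norm_integral_le_of_norm_le_const
      (Filter.Eventually.of_forall fun y => hC x y))

lemma Good.add {f g : X → X → ℝ} (hf : Good f) (hg : Good g) :
    Good (fun x y => f x y + g x y) := by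
  obtain ⟨hc, C, hC⟩ := hf
  obtain ⟨hc', C', hC'⟩ := hg
  exact ⟨hc.add hc', C + C', fun x y => (abs_add_le _ _).trans (add_le_add (hC x y) (hC' x y))⟩

lemma dblInt_add {f g : X → X → ℝ} (hf : Good f) (hg : Good g) (μp μm : Measure X)
    [IsFiniteMeasure μp] [IsFiniteMeasure μm] :
    dblInt (fun x y => f x y + g x y) μp μm = dblInt f μp μm + dblInt g μp μm := by
  have key : ∀ (μ ν : Measure X) [IsFiniteMeasure μ] [IsFiniteMeasure ν],
      ∫ x, ∫ y, f x y + g x y ∂μ ∂ν = ∫ x, ∫ y, f x y ∂μ ∂ν + ∫ x, ∫ y, g x y ∂μ ∂ν := by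
    intro μ ν _ _
    rw [← integral_add (hf.int2 μ ν) (hg.int2 μ ν)]
    refine integral_congr_ae (Filter.Eventually.of_forall fun x => ?_)
    exact integral_add (hf.int1 μ x) (hg.int1 μ x)
  unfold dblInt
  rw [key, key, key, key]
  ring

lemma dblInt_mul (g h : X → ℝ) (μp μm : Measure X) :
    dblInt (fun x y => g x * h y) μp μm =
      (∫ x, g x ∂μp - ∫ x, g x ∂μm) * (∫ x, h x ∂μp - ∫ x, h x ∂μm) := by
  unfold dblInt
  simp only [integral_const_mul, integral_mul_const]
  ring

lemma te (t : ℝ) : t * Real.exp (-t) ≤ 1 := by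
  have h1 := Real.add_one_le_exp t
  have h2 := Real.exp_pos (-t)
  have h3 : Real.exp t * Real.exp (-t) = 1 := by rw [← Real.exp_add]; simp
  nlinarith

lemma main (hsnt : SNT X) (z : X) (μp μm : Measure X) [IsFiniteMeasure μp] [IsFiniteMeasure μm]
    (h0 : dblInt (fun x y => Real.exp (-dist x y)) μp μm = 0) : μp = μm := by
  set u : X → ℝ := fun x => Real.exp (-dist x z) with hu
  have hupos : ∀ x, 0 < u x := fun x => Real.exp_pos _
  have hucont : Continuous u := by fun_prop
  have hu1 : ∀ x, u x ≤ 1 := fun x => by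
    simp only [hu, Real.exp_le_one_iff]; linarith [dist_nonneg (x := x) (y := z)]
  have huu : ∀ x y, u x * u y = Real.exp (-(dist x z + dist y z)) := fun x y => by
    simp only [hu]; rw [← Real.exp_add]; congr 1; ring
  have huu1 : ∀ x y, u x * u y ≤ 1 := fun x y => by
    nlinarith [hu1 x, hu1 y, hupos x, hupos y]
  have huud : ∀ x y, u x * u y * (dist x z + dist y z) ≤ 1 := fun x y => by
    rw [huu, mul_comm]; exact te _
  have huu0 : ∀ x y, 0 < u x * u y := fun x y => mul_pos (hupos x) (hupos y)
  have hKc : Continuous fun p : X × X => Kc z p.1 p.2 := by unfold Kc; fun_prop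
  have htri : ∀ x y, dist x y ≤ dist x z + dist y z := fun x y => dist_triangle_right x y z
  have hK0 : ∀ x y, 0 ≤ Kc z x y := fun x y => by unfold Kc; linarith [htri x y]
  have hK1 : ∀ x y, Kc z x y ≤ dist x z + dist y z := fun x y => by
    unfold Kc; linarith [dist_nonneg (x := x) (y := y)]
  set f0 : X → X → ℝ := fun x y => u x * u y with hf0
  set f1 : X → X → ℝ := fun x y => u x * u y * Kc z x y with hf1
  set f2 : X → X → ℝ := fun x y => u x * u y * (Real.exp (Kc z x y) - 1 - Kc z x y) with hf2
  have hf1b : ∀ x y, |f1 x y| ≤ 1 := fun x y => by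
    rw [abs_of_nonneg (mul_nonneg (huu0 x y).le (hK0 x y))]
    exact (mul_le_mul_of_nonneg_left (hK1 x y) (huu0 x y).le).trans (huud x y)
  have hexp : ∀ x y, u x * u y * Real.exp (Kc z x y) = Real.exp (-dist x y) := fun x y => by
    rw [huu, ← Real.exp_add]; congr 1; unfold Kc; ring
  have hf2b : ∀ x y, |f2 x y| ≤ 1 := fun x y => by
    have h1 : 0 ≤ Real.exp (Kc z x y) - 1 - Kc z x y := by
      linarith [Real.add_one_le_exp (Kc z x y)]
    rw [abs_of_nonneg (mul_nonneg (huu0 x y).le h1)]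
    have h2 : Real.exp (-dist x y) ≤ 1 := by
      rw [Real.exp_le_one_iff]; linarith [dist_nonneg (x := x) (y := y)]
    have h3 := hexp x y
    have h4 := mul_nonneg (huu0 x y).le (hK0 x y)
    have h5 := huu0 x y
    calc u x * u y * (Real.exp (Kc z x y) - 1 - Kc z x y)
        = u x * u y * Real.exp (Kc z x y) - u x * u y - u x * u y * Kc z x y := by ring
      _ ≤ 1 := by linarith
  have g0 : Good f0 := ⟨by fun_prop, 1, fun x y => by
    rw [abs_of_nonneg (huu0 x y).le]; exact huu1 x y⟩
  have g1 : Good f1 := ⟨by fun_prop, 1, hf1b⟩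
  have g2 : Good f2 := ⟨by fun_prop, 1, hf2b⟩
  have p0 : (Matrix.of f0).PosSemidef := rankone_psd u
  have p1 : (Matrix.of f1).PosSemidef := p0.hadamard (Kc_psd hsnt z)
  have p2 : (Matrix.of f2).PosSemidef := p0.hadamard (exp_psd _ (Kc_psd hsnt z))
  have n0 := dblInt_nonneg f0 p0 g0.1 1 (fun x => huu1 x x) μp μm
  have n1 := dblInt_nonneg f1 p1 g1.1 1 (fun x => (le_abs_self _).trans (hf1b x x)) μp μm
  have n2 := dblInt_nonneg f2 p2 g2.1 1 (fun x => (le_abs_self _).trans (hf2b x x)) μp μm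
  have hsum : (fun x y => Real.exp (-dist x y)) = fun x y => (f0 x y + f1 x y) + f2 x y := by
    funext x y
    rw [← hexp x y]
    simp only [hf0, hf1, hf2]
    ring
  rw [hsum, dblInt_add (g0.add g1) g2, dblInt_add g0 g1] at h0
  have z0 : dblInt f0 μp μm = 0 := by linarith
  have z1 : dblInt f1 μp μm = 0 := by linarith
  have hmass : ∫ x, u x ∂μp = ∫ x, u x ∂μm := by
    rw [hf0, dblInt_mul] at z0
    exact sub_eq_zero.mp (mul_self_eq_zero.mp z0)
  -- the distance form of the weighted measures
  have gd : Good (fun x y => u x * u y * dist x y) := ⟨by fun_prop, 1, fun x y => by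
    rw [abs_of_nonneg (mul_nonneg (huu0 x y).le dist_nonneg)]
    exact (mul_le_mul_of_nonneg_left (htri x y) (huu0 x y).le).trans (huud x y)⟩
  have hdd : ∀ x, u x * dist x z ≤ 1 := fun x => by
    rw [mul_comm]; exact te _
  have ga : Good (fun x y => (u x * dist x z) * u y) := ⟨by fun_prop, 1, fun x y => by
    have h1 := mul_nonneg (hupos x).le (dist_nonneg (x := x) (y := z))
    rw [abs_of_nonneg (mul_nonneg h1 (hupos y).le)]
    nlinarith [hdd x, hu1 y, hupos y]⟩
  have gb : Good (fun x y => u x * (u y * dist y z)) := ⟨by fun_prop, 1, fun x y => by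
    have h1 := mul_nonneg (hupos y).le (dist_nonneg (x := y) (y := z))
    rw [abs_of_nonneg (mul_nonneg (hupos x).le h1)]
    nlinarith [hdd y, hu1 x, hupos x]⟩
  have zd : dblInt (fun x y => u x * u y * dist x y) μp μm = 0 := by
    have e1 : (fun x y => (u x * dist x z) * u y + u x * (u y * dist y z)) =
        fun x y => f1 x y + u x * u y * dist x y := by
      funext x y
      simp only [hf1, Kc]
      ring
    have e2 := dblInt_add ga gb μp μm
    rw [e1, dblInt_add g1 gd, z1, dblInt_mul (fun x => u x * dist x z) u,
      dblInt_mul u (fun x => u x * dist x z), hmass] at e2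
    simpa using e2
  -- weighted measures
  let w : X → NNReal := fun x => ⟨u x, (hupos x).le⟩
  have hw : Measurable w := hucont.measurable.subtype_mk
  have hwu : ∀ x, ((w x : NNReal) : ENNReal) = ENNReal.ofReal (u x) := fun x => by
    rw [ENNReal.ofReal, Real.toNNReal_of_nonneg (hupos x).le]
    rfl
  have ui : ∀ (μ : Measure X) [IsFiniteMeasure μ], Integrable u μ := fun μ _ =>
    Integrable.of_bound (C := 1) hucont.aestronglyMeasurable
      (Filter.Eventually.of_forall fun x => by
        rw [Real.norm_eq_abs, abs_of_pos (hupos x)]; exact hu1 x)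
  let W : Measure X → Measure X := fun μ => μ.withDensity (fun x => (w x : ENNReal))
  have Wuniv : ∀ (μ : Measure X) [IsFiniteMeasure μ],
      W μ Set.univ = ENNReal.ofReal (∫ x, u x ∂μ) := fun μ _ => by
    rw [ofReal_integral_eq_lintegral_ofReal (ui μ)
      (Filter.Eventually.of_forall fun x => (hupos x).le)]
    simp only [W, withDensity_apply _ MeasurableSet.univ, Measure.restrict_univ, hwu]
  have Wfin : ∀ (μ : Measure X) [IsFiniteMeasure μ], IsFiniteMeasure (W μ) := fun μ _ =>
    ⟨by rw [Wuniv]; exact ENNReal.ofReal_lt_top⟩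
  have Wint : ∀ (μ : Measure X) (g : X → ℝ), ∫ x, g x ∂(W μ) = ∫ x, u x * g x ∂μ :=
    fun μ g => by
      simp only [W]
      rw [integral_withDensity_eq_integral_smul hw]
      rfl
  have Wdist : ∀ (μ : Measure X) [IsFiniteMeasure μ],
      ∫⁻ x, ENNReal.ofReal (dist x z) ∂(W μ) < ⊤ := fun μ _ => by
    simp only [W]
    rw [lintegral_withDensity_eq_lintegral_mul _ hw.coe_nnreal_ennreal (by fun_prop)]
    refine lt_of_le_of_lt (lintegral_mono (g := fun _ => 1) fun x => ?_) (by simp)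
    simp only [Pi.mul_apply, hwu]
    rw [← ENNReal.ofReal_mul (hupos x).le]
    exact ENNReal.ofReal_le_one.mpr (hdd x)
  have hWW : W μp = W μm := by
    refine hsnt _ _ (Wfin μp) (Wfin μm) ?_ ⟨z, ?_⟩ ?_
    · rw [Wuniv, Wuniv, hmass]
    · rw [lintegral_add_measure]
      exact ENNReal.add_lt_top.mpr ⟨Wdist μp, Wdist μm⟩
    · rw [← zd]
      unfold dblInt
      simp only [Wint, mul_assoc, integral_const_mul]
  have back : ∀ μ : Measure X, (W μ).withDensity (fun x => ((w x : ENNReal))⁻¹) = μ := fun μ => by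
    simp only [W]
    refine withDensity_inv_same hw.coe_nnreal_ennreal ?_ ?_
    · refine Filter.Eventually.of_forall fun x => ?_
      rw [hwu]; simpa using hupos x
    · exact Filter.Eventually.of_forall fun x => ENNReal.coe_ne_top
  rw [← back μp, hWW, back]

end

theorem stmt8 {X : Type*} [MetricSpace X] [MeasurableSpace X] [BorelSpace X]
    (hsnt : ∀ (μp μm : Measure X), IsFiniteMeasure μp → IsFiniteMeasure μm →
      μp Set.univ = μm Set.univ →
      (∃ z₀ : X, (∫⁻ x, ENNReal.ofReal (dist x z₀) ∂(μp + μm)) < ⊤) →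
      dblInt (fun x y => dist x y) μp μm = 0 → μp = μm) :
    ∀ (μp μm : Measure X), IsFiniteMeasure μp → IsFiniteMeasure μm →
      μp Set.univ = μm Set.univ →
      dblInt (fun x y => Real.exp (-dist x y)) μp μm = 0 → μp = μm := by
  intro μp μm _ _ _ h0
  rcases isEmpty_or_nonempty X with h | ⟨⟨z⟩⟩
  · exact Subsingleton.elim _ _
  · exact main hsnt z μp μm h0
end

section
/- Let 𝒳 be a Polish space, H a separable real Hilbert space, and T: 𝒳 → H a Borel measurable injective map. Then for every finite signed Borel measure μ on 𝒳, if ∫∫ exp(-‖T(x) - T(x′)‖²/2) dμ(x) dμ(x′) = 0 then μ = 0; that is, the kernel k(x,x′) = exp(-‖T(x)-T(x′)‖²/2) is integrally strictly positive definite with respect to all finite signed Borel measures on 𝒳. -/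
open MeasureTheory Real

open ProbabilityTheory Filter Topology in
lemma aux_gauss_cos {F : Type*} [NormedAddCommGroup F] [InnerProductSpace ℝ F]
    [FiniteDimensional ℝ F] [MeasurableSpace F] [BorelSpace F] (t : F) :
    Real.exp (-‖t‖ ^ 2 / 2) = ∫ w, Real.cos (inner ℝ w t) ∂(stdGaussian F) := by
  have h := congrArg Complex.re (charFun_stdGaussian (E := F) t)
  have hint : Integrable (fun w : F => Complex.exp (((inner ℝ w t : ℝ) : ℂ) * Complex.I))
      (stdGaussian F) := by
    refine Integrable.of_bound (by fun_prop) 1 (ae_of_all _ fun w => ?_)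
    rw [Complex.norm_exp_ofReal_mul_I]
  rw [charFun_apply] at h
  have h2 := integral_re hint
  simp only [RCLike.re_to_complex, Complex.exp_ofReal_mul_I_re] at h2
  rw [h2, h]
  have : (-(‖t‖ : ℂ) ^ 2 / 2) = ((-‖t‖ ^ 2 / 2 : ℝ) : ℂ) := by push_cast; ring
  rw [this, Complex.exp_ofReal_re]

open ProbabilityTheory Filter Topology in
lemma aux_K_formula {Ω F : Type*} [MeasurableSpace Ω] [NormedAddCommGroup F]
    [InnerProductSpace ℝ F]
    [FiniteDimensional ℝ F] [MeasurableSpace F] [BorelSpace F] (f : Ω → F) (hf : Measurable f)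
    (a b : Measure Ω) [IsFiniteMeasure a] [IsFiniteMeasure b] :
    (∫ x, ∫ y, Real.exp (-‖f x - f y‖ ^ 2 / 2) ∂b ∂a) =
      ∫ w, ((∫ x, Real.cos (inner ℝ w (f x)) ∂a) * (∫ x, Real.cos (inner ℝ w (f x)) ∂b)
        + (∫ x, Real.sin (inner ℝ w (f x)) ∂a) * (∫ x, Real.sin (inner ℝ w (f x)) ∂b))
        ∂(stdGaussian F) := by
  have hc (c : Measure Ω) [IsFiniteMeasure c] (w : F) :
      Integrable (fun x => Real.cos (inner ℝ w (f x))) c :=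
    Integrable.of_bound (by fun_prop) 1 (ae_of_all _ fun x => by
      simpa using Real.abs_cos_le_one _)
  have hs (c : Measure Ω) [IsFiniteMeasure c] (w : F) :
      Integrable (fun x => Real.sin (inner ℝ w (f x))) c :=
    Integrable.of_bound (by fun_prop) 1 (ae_of_all _ fun x => by
      simpa using Real.abs_sin_le_one _)
  have step1 (x : Ω) : ∫ y, Real.exp (-‖f x - f y‖ ^ 2 / 2) ∂b =
      ∫ w, (Real.cos (inner ℝ w (f x)) * (∫ y, Real.cos (inner ℝ w (f y)) ∂b)
        + Real.sin (inner ℝ w (f x)) * (∫ y, Real.sin (inner ℝ w (f y)) ∂b))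
        ∂(stdGaussian F) := by
    simp_rw [aux_gauss_cos]
    rw [integral_integral_swap]
    · congr 1
      ext w
      simp_rw [inner_sub_right, Real.cos_sub]
      rw [integral_add ((hc b w).const_mul _) ((hs b w).const_mul _), integral_const_mul,
        integral_const_mul]
    · refine Integrable.of_bound ?_ 1 (ae_of_all _ fun x => by
        simpa [Function.uncurry] using Real.abs_cos_le_one _)
      apply Measurable.aestronglyMeasurable
      simp only [Function.uncurry_def]
      fun_prop
  simp_rw [step1]
  have mC : StronglyMeasurable (fun w : F => ∫ y, Real.cos (inner ℝ w (f y)) ∂b) := by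
    refine StronglyMeasurable.integral_prod_right' (f := fun p : F × Ω =>
      Real.cos (inner ℝ p.1 (f p.2))) ?_
    apply Measurable.stronglyMeasurable
    fun_prop
  have mS : StronglyMeasurable (fun w : F => ∫ y, Real.sin (inner ℝ w (f y)) ∂b) := by
    refine StronglyMeasurable.integral_prod_right' (f := fun p : F × Ω =>
      Real.sin (inner ℝ p.1 (f p.2))) ?_
    apply Measurable.stronglyMeasurable
    fun_prop
  have bC (w : F) : |∫ y, Real.cos (inner ℝ w (f y)) ∂b| ≤ b.real Set.univ := by
    have := norm_integral_le_of_norm_le_const (μ := b) (C := 1)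
      (f := fun y => Real.cos (inner ℝ w (f y)))
      (ae_of_all _ fun x => by simpa using Real.abs_cos_le_one _)
    simpa using this
  have bS (w : F) : |∫ y, Real.sin (inner ℝ w (f y)) ∂b| ≤ b.real Set.univ := by
    have := norm_integral_le_of_norm_le_const (μ := b) (C := 1)
      (f := fun y => Real.sin (inner ℝ w (f y)))
      (ae_of_all _ fun x => by simpa using Real.abs_sin_le_one _)
    simpa using this
  rw [integral_integral_swap]
  · congr 1
    ext w
    rw [integral_add ((hc a w).mul_const _) ((hs a w).mul_const _), integral_mul_const,
        integral_mul_const]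
  · have mC' := mC.measurable
    have mS' := mS.measurable
    refine Integrable.of_bound ?_ (1 * b.real Set.univ + 1 * b.real Set.univ)
      (ae_of_all _ fun x => ?_)
    · apply Measurable.aestronglyMeasurable
      simp only [Function.uncurry_def]
      have h1 : Measurable fun p : Ω × F => ∫ y, Real.cos (inner ℝ p.2 (f y)) ∂b :=
        mC'.comp measurable_snd
      have h2 : Measurable fun p : Ω × F => ∫ y, Real.sin (inner ℝ p.2 (f y)) ∂b :=
        mS'.comp measurable_snd
      fun_prop
    · simp only [Function.uncurry_def, Real.norm_eq_abs]
      refine (abs_add_le _ _).trans ?_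
      rw [abs_mul, abs_mul]
      gcongr
      · exact Real.abs_cos_le_one _
      · exact bC _
      · exact Real.abs_sin_le_one _
      · exact bS _

open ProbabilityTheory Filter Topology in
lemma aux_psd_fin {Ω F : Type*} [MeasurableSpace Ω] [NormedAddCommGroup F]
    [InnerProductSpace ℝ F]
    [FiniteDimensional ℝ F] [MeasurableSpace F] [BorelSpace F] (f : Ω → F) (hf : Measurable f)
    (a b : Measure Ω) [IsFiniteMeasure a] [IsFiniteMeasure b] :
    0 ≤ (∫ x, ∫ y, Real.exp (-‖f x - f y‖ ^ 2 / 2) ∂a ∂a)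
        + (∫ x, ∫ y, Real.exp (-‖f x - f y‖ ^ 2 / 2) ∂b ∂b)
        - 2 * (∫ x, ∫ y, Real.exp (-‖f x - f y‖ ^ 2 / 2) ∂b ∂a) := by
  have mC (c : Measure Ω) [IsFiniteMeasure c] :
      Measurable (fun w : F => ∫ y, Real.cos (inner ℝ w (f y)) ∂c) := by
    refine (StronglyMeasurable.integral_prod_right' (f := fun p : F × Ω =>
      Real.cos (inner ℝ p.1 (f p.2))) ?_).measurable
    apply Measurable.stronglyMeasurable
    fun_prop
  have mS (c : Measure Ω) [IsFiniteMeasure c] :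
      Measurable (fun w : F => ∫ y, Real.sin (inner ℝ w (f y)) ∂c) := by
    refine (StronglyMeasurable.integral_prod_right' (f := fun p : F × Ω =>
      Real.sin (inner ℝ p.1 (f p.2))) ?_).measurable
    apply Measurable.stronglyMeasurable
    fun_prop
  have bC (c : Measure Ω) [IsFiniteMeasure c] (w : F) :
      |∫ y, Real.cos (inner ℝ w (f y)) ∂c| ≤ c.real Set.univ := by
    have := norm_integral_le_of_norm_le_const (μ := c) (C := 1)
      (f := fun y => Real.cos (inner ℝ w (f y)))
      (ae_of_all _ fun x => by simpa using Real.abs_cos_le_one _)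
    simpa using this
  have bS (c : Measure Ω) [IsFiniteMeasure c] (w : F) :
      |∫ y, Real.sin (inner ℝ w (f y)) ∂c| ≤ c.real Set.univ := by
    have := norm_integral_le_of_norm_le_const (μ := c) (C := 1)
      (f := fun y => Real.sin (inner ℝ w (f y)))
      (ae_of_all _ fun x => by simpa using Real.abs_sin_le_one _)
    simpa using this
  have hI (c d : Measure Ω) [IsFiniteMeasure c] [IsFiniteMeasure d] :
      Integrable (fun w => ((∫ x, Real.cos (inner ℝ w (f x)) ∂c) *
        (∫ x, Real.cos (inner ℝ w (f x)) ∂d)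
        + (∫ x, Real.sin (inner ℝ w (f x)) ∂c) * (∫ x, Real.sin (inner ℝ w (f x)) ∂d)))
        (stdGaussian F) := by
    refine Integrable.of_bound (((mC c).mul (mC d)).add
      ((mS c).mul (mS d))).aestronglyMeasurable
      (c.real Set.univ * d.real Set.univ + c.real Set.univ * d.real Set.univ)
      (ae_of_all _ fun w => ?_)
    rw [Real.norm_eq_abs]
    refine (abs_add_le _ _).trans ?_
    rw [abs_mul, abs_mul]
    gcongr
    · exact bC c _
    · exact bC d _
    · exact bS c _
    · exact bS d _
  rw [aux_K_formula f hf a a, aux_K_formula f hf b b, aux_K_formula f hf a b,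
    ← integral_const_mul, ← integral_add (hI a a) (hI b b),
    ← integral_sub (by exact (hI a a).add (hI b b)) ((hI a b).const_mul 2)]
  refine integral_nonneg fun w => ?_
  simp only [Pi.zero_apply, Pi.add_apply]
  set A := ∫ x, Real.cos (inner ℝ w (f x)) ∂a
  set B := ∫ x, Real.cos (inner ℝ w (f x)) ∂b
  set A' := ∫ x, Real.sin (inner ℝ w (f x)) ∂a
  set B' := ∫ x, Real.sin (inner ℝ w (f x)) ∂b
  nlinarith [sq_nonneg (A - B), sq_nonneg (A' - B')]

lemma aux_exp_le {F : Type*} [NormedAddCommGroup F] (t : F) :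
    ‖Real.exp (-‖t‖ ^ 2 / 2)‖ ≤ 1 := by
  rw [Real.norm_eq_abs, abs_of_pos (Real.exp_pos _), Real.exp_le_one_iff]
  have := sq_nonneg ‖t‖
  linarith

open Filter Topology in
lemma aux_psd {H : Type*} [NormedAddCommGroup H] [InnerProductSpace ℝ H]
    [SecondCountableTopology H] [MeasurableSpace H] [BorelSpace H]
    (a b : Measure H) [IsFiniteMeasure a] [IsFiniteMeasure b] :
    0 ≤ (∫ x, ∫ y, Real.exp (-‖x - y‖ ^ 2 / 2) ∂a ∂a)
        + (∫ x, ∫ y, Real.exp (-‖x - y‖ ^ 2 / 2) ∂b ∂b)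
        - 2 * (∫ x, ∫ y, Real.exp (-‖x - y‖ ^ 2 / 2) ∂b ∂a) := by
  let g : ℕ → SimpleFunc H H := SimpleFunc.approxOn (id : H → H) measurable_id Set.univ 0
    (Set.mem_univ _)
  have hg (x : H) : Tendsto (fun n => g n x) atTop (𝓝 x) :=
    SimpleFunc.tendsto_approxOn measurable_id (Set.mem_univ _) (by simp)
  have hlim (c d : Measure H) [IsFiniteMeasure c] [IsFiniteMeasure d] :
      Tendsto (fun n => ∫ x, ∫ y, Real.exp (-‖g n x - g n y‖ ^ 2 / 2) ∂d ∂c) atTop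
        (𝓝 (∫ x, ∫ y, Real.exp (-‖x - y‖ ^ 2 / 2) ∂d ∂c)) := by
    refine tendsto_integral_of_dominated_convergence (fun _ => d.real Set.univ) ?_
      (integrable_const _) ?_ ?_
    · intro n
      refine (StronglyMeasurable.integral_prod_right' (f := fun p : H × H =>
        Real.exp (-‖g n p.1 - g n p.2‖ ^ 2 / 2)) ?_).aestronglyMeasurable
      apply Measurable.stronglyMeasurable
      have := (g n).measurable
      fun_prop
    · intro n
      refine ae_of_all _ fun x => ?_
      have := norm_integral_le_of_norm_le_const (μ := d) (C := 1)
        (f := fun y => Real.exp (-‖g n x - g n y‖ ^ 2 / 2))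
        (ae_of_all _ fun y => aux_exp_le _)
      simpa using this
    · refine ae_of_all _ fun x => ?_
      refine tendsto_integral_of_dominated_convergence (fun _ => 1) ?_
        (integrable_const _) ?_ ?_
      · intro n
        apply Measurable.aestronglyMeasurable
        have := (g n).measurable
        fun_prop
      · exact fun n => ae_of_all _ fun y => aux_exp_le _
      · refine ae_of_all _ fun y => ?_
        exact (Real.continuous_exp.tendsto _).comp
          ((((((hg x).sub (hg y)).norm).pow 2).neg).div_const 2)
  refine ge_of_tendsto' (((hlim a a).add (hlim b b)).sub ((hlim a b).const_mul 2)) fun n => ?_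
  let F : Submodule ℝ H := Submodule.span ℝ (Set.range (g n))
  have hfd : FiniteDimensional ℝ F := FiniteDimensional.span_of_finite ℝ (g n).finite_range
  let f : H → F := fun x => ⟨g n x, Submodule.subset_span ⟨x, rfl⟩⟩
  have hf : Measurable f := (g n).measurable.subtype_mk
  exact aux_psd_fin f hf a b

lemma aux_int {H : Type*} [NormedAddCommGroup H]
    [SecondCountableTopology H] [MeasurableSpace H] [BorelSpace H]
    (a : Measure H) [IsFiniteMeasure a] (x : H) :
    Integrable (fun y => Real.exp (-‖x - y‖ ^ 2 / 2)) a :=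
  Integrable.of_bound (by fun_prop) 1 (ae_of_all _ fun y => aux_exp_le _)

lemma aux_int_prod {H : Type*} [NormedAddCommGroup H]
    [SecondCountableTopology H] [MeasurableSpace H] [BorelSpace H]
    (a b : Measure H) [IsFiniteMeasure a] [IsFiniteMeasure b] :
    Integrable (Function.uncurry fun x y : H => Real.exp (-‖x - y‖ ^ 2 / 2)) (a.prod b) := by
  refine Integrable.of_bound ?_ 1 (ae_of_all _ fun y => aux_exp_le _)
  simp only [Function.uncurry_def]
  apply Measurable.aestronglyMeasurable
  fun_prop

lemma aux_symm {H : Type*} [NormedAddCommGroup H]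
    [SecondCountableTopology H] [MeasurableSpace H] [BorelSpace H]
    (a b : Measure H) [IsFiniteMeasure a] [IsFiniteMeasure b] :
    (∫ x, ∫ y, Real.exp (-‖x - y‖ ^ 2 / 2) ∂b ∂a) =
      ∫ x, ∫ y, Real.exp (-‖x - y‖ ^ 2 / 2) ∂a ∂b := by
  rw [integral_integral_swap (aux_int_prod a b)]
  simp_rw [norm_sub_rev]

lemma aux_le {H : Type*} [NormedAddCommGroup H] [InnerProductSpace ℝ H]
    [SecondCountableTopology H] [MeasurableSpace H] [BorelSpace H]
    (p m : Measure H) [IsFiniteMeasure p] [IsFiniteMeasure m]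
    (h : (∫ x, ∫ y, Real.exp (-‖x - y‖ ^ 2 / 2) ∂p ∂p)
        + (∫ x, ∫ y, Real.exp (-‖x - y‖ ^ 2 / 2) ∂m ∂m)
        - 2 * (∫ x, ∫ y, Real.exp (-‖x - y‖ ^ 2 / 2) ∂m ∂p) = 0) (z : H) :
    (∫ y, Real.exp (-‖z - y‖ ^ 2 / 2) ∂m) ≤ ∫ y, Real.exp (-‖z - y‖ ^ 2 / 2) ∂p := by
  have hadd (c : Measure H) [IsFiniteMeasure c] (t : NNReal) (x : H) :
      (∫ y, Real.exp (-‖x - y‖ ^ 2 / 2) ∂(c + t • Measure.dirac z)) =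
        (∫ y, Real.exp (-‖x - y‖ ^ 2 / 2) ∂c) + t * Real.exp (-‖x - z‖ ^ 2 / 2) := by
    rw [integral_add_measure (aux_int _ _) (aux_int _ _), integral_smul_nnreal_measure,
      integral_dirac]
    rfl
  have hI (c d : Measure H) [IsFiniteMeasure c] [IsFiniteMeasure d] :
      Integrable (fun x => ∫ y, Real.exp (-‖x - y‖ ^ 2 / 2) ∂d) c :=
    (aux_int_prod c d).integral_prod_left
  have hadd2 (c d : Measure H) [IsFiniteMeasure c] [IsFiniteMeasure d] (t : NNReal) :
      (∫ x, ∫ y, Real.exp (-‖x - y‖ ^ 2 / 2) ∂d ∂(c + t • Measure.dirac z)) =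
        (∫ x, ∫ y, Real.exp (-‖x - y‖ ^ 2 / 2) ∂d ∂c)
          + t * ∫ y, Real.exp (-‖z - y‖ ^ 2 / 2) ∂d := by
    rw [integral_add_measure (hI _ _) (hI _ _), integral_smul_nnreal_measure,
      integral_dirac]
    rfl
  set u := ∫ y, Real.exp (-‖z - y‖ ^ 2 / 2) ∂m with hu
  set v := ∫ y, Real.exp (-‖z - y‖ ^ 2 / 2) ∂p with hv
  have key (t : NNReal) : 0 ≤ 2 * t * (v - u) + (t : ℝ) ^ 2 := by
    have h1 := aux_psd (p + t • Measure.dirac z) m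
    rw [hadd2 p m, hadd2 p (p + t • Measure.dirac z), hadd p t z,
      aux_symm p (p + t • Measure.dirac z), hadd2 p p, ← hu, ← hv] at h1
    simp only [sub_self, norm_zero] at h1
    norm_num at h1
    nlinarith
  by_contra! hlt
  have := key ⟨u - v, by linarith⟩
  change 0 ≤ 2 * (u - v) * (v - u) + (u - v) ^ 2 at this
  nlinarith

lemma aux_eq {H : Type*} [NormedAddCommGroup H] [InnerProductSpace ℝ H]
    [SecondCountableTopology H] [MeasurableSpace H] [BorelSpace H]
    (p m : Measure H) [IsFiniteMeasure p] [IsFiniteMeasure m]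
    (h : (∫ x, ∫ y, Real.exp (-‖x - y‖ ^ 2 / 2) ∂p ∂p)
        + (∫ x, ∫ y, Real.exp (-‖x - y‖ ^ 2 / 2) ∂m ∂m)
        - 2 * (∫ x, ∫ y, Real.exp (-‖x - y‖ ^ 2 / 2) ∂m ∂p) = 0) (z : H) :
    (∫ y, Real.exp (-‖z - y‖ ^ 2 / 2) ∂p) = ∫ y, Real.exp (-‖z - y‖ ^ 2 / 2) ∂m := by
  refine le_antisymm (aux_le m p ?_ z) (aux_le p m h z)
  rw [aux_symm m p]
  linarith

open ProbabilityTheory in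
lemma aux_final {H : Type*} [NormedAddCommGroup H] [InnerProductSpace ℝ H] [CompleteSpace H]
    [SecondCountableTopology H] [MeasurableSpace H] [BorelSpace H]
    (p m : Measure H) [IsFiniteMeasure p] [IsFiniteMeasure m]
    (h : ∀ z : H, (∫ y, Real.exp (-‖z - y‖ ^ 2 / 2) ∂p) =
      ∫ y, Real.exp (-‖z - y‖ ^ 2 / 2) ∂m) : p = m := by
  let ρ : H → ENNReal := fun x => ENNReal.ofReal (Real.exp (-‖x‖ ^ 2 / 2))
  have hρ : Measurable ρ := by fun_prop
  have hρ0 (x : H) : ρ x ≠ 0 := by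
    simpa [ρ] using Real.exp_pos _
  have hρt (x : H) : ρ x ≠ ⊤ := ENNReal.ofReal_ne_top
  have hfin (c : Measure H) [IsFiniteMeasure c] : IsFiniteMeasure (c.withDensity ρ) := by
    refine isFiniteMeasure_withDensity_ofReal ?_
    have := aux_int c 0
    simp only [zero_sub, norm_neg] at this
    exact this.2
  have hexp (z y : H) : Real.exp (-‖y‖ ^ 2 / 2) * Real.exp (inner ℝ y z) =
      Real.exp (‖z‖ ^ 2 / 2) * Real.exp (-‖z - y‖ ^ 2 / 2) := by
    rw [← Real.exp_add, ← Real.exp_add, norm_sub_sq_real, real_inner_comm]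
    congr 1
    ring
  have hint (c : Measure H) [IsFiniteMeasure c] (z : H) :
      Integrable (fun y => Real.exp (inner ℝ y z)) (c.withDensity ρ) := by
    rw [integrable_withDensity_iff_integrable_smul' hρ (ae_of_all _ fun x => (hρt x).lt_top)]
    simp only [ρ, ENNReal.toReal_ofReal (Real.exp_pos _).le, smul_eq_mul, hexp]
    exact (aux_int c z).const_mul _
  have hval (c : Measure H) [IsFiniteMeasure c] (z : H) :
      ∫ y, Real.exp (inner ℝ y z) ∂(c.withDensity ρ) =
        Real.exp (‖z‖ ^ 2 / 2) * ∫ y, Real.exp (-‖z - y‖ ^ 2 / 2) ∂c := by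
    rw [integral_withDensity_eq_integral_toReal_smul hρ (ae_of_all _ fun x => (hρt x).lt_top)]
    simp only [ρ, ENNReal.toReal_ofReal (Real.exp_pos _).le, smul_eq_mul, hexp]
    rw [integral_const_mul]
  have := hfin p
  have := hfin m
  have hmgf (z : H) : mgf (fun y => inner ℝ y z) (p.withDensity ρ) =
      mgf (fun y => inner ℝ y z) (m.withDensity ρ) := by
    ext t
    simp only [mgf, ← real_inner_smul_right]
    rw [hval, hval, h]
  have hmass : (p.withDensity ρ).real Set.univ = (m.withDensity ρ).real Set.univ := by
    have := congrFun (hmgf 0) 0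
    simpa using this
  have hzero : p.withDensity ρ = 0 ↔ m.withDensity ρ = 0 := by
    rw [← Measure.measure_univ_eq_zero, ← Measure.measure_univ_eq_zero,
      ← measureReal_eq_zero_iff, ← measureReal_eq_zero_iff, hmass]
  have hset (z : H) : integrableExpSet (fun y => inner ℝ y z) (p.withDensity ρ) = Set.univ := by
    ext t
    simp only [integrableExpSet, Set.mem_ofPred_eq, Set.mem_univ, iff_true,
      ← real_inner_smul_right]
    exact hint p _
  have hnu : p.withDensity ρ = m.withDensity ρ := by
    apply Measure.ext_of_charFun
    ext z
    have h1 := eqOn_complexMGF_of_mgf' (hmgf z) hzero (x := Complex.I) (by simp [hset])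
    simp only [complexMGF] at h1
    simp only [charFun_apply]
    simpa only [mul_comm] using h1
  rw [← withDensity_inv_same (μ := p) hρ (ae_of_all _ hρ0) (ae_of_all _ hρt), hnu,
    withDensity_inv_same (μ := m) hρ (ae_of_all _ hρ0) (ae_of_all _ hρt)]

theorem stmt12 {𝒳 H : Type*} [TopologicalSpace 𝒳] [PolishSpace 𝒳]
    [MeasurableSpace 𝒳] [BorelSpace 𝒳]
    [NormedAddCommGroup H] [InnerProductSpace ℝ H] [CompleteSpace H]
    [TopologicalSpace.SeparableSpace H] [MeasurableSpace H] [BorelSpace H]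
    (T : 𝒳 → H) (hTmeas : Measurable T) (hTinj : Function.Injective T)
    (μp μm : Measure 𝒳) [IsFiniteMeasure μp] [IsFiniteMeasure μm]
    (h : (∫ x, ∫ y, Real.exp (-‖T x - T y‖ ^ 2 / 2) ∂μp ∂μp)
        + (∫ x, ∫ y, Real.exp (-‖T x - T y‖ ^ 2 / 2) ∂μm ∂μm)
        - 2 * (∫ x, ∫ y, Real.exp (-‖T x - T y‖ ^ 2 / 2) ∂μm ∂μp) = 0) :
    μp = μm := by
  have : SecondCountableTopology H := UniformSpace.secondCountable_of_separable H
  have hemb : MeasurableEmbedding T := hTmeas.measurableEmbedding hTinj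
  apply hemb.map_injective
  apply aux_final
  apply aux_eq
  simpa only [hemb.integral_map] using h
end
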